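/- Suppose δ(s,μ) ≤ 0.5. Then x(s,μ) is primal feasible, i.e., A x(s,μ) = b and x(s,μ) ≥ 0 entrywise. Moreover, if an inexactness vector E = −Aᵀε (for some ε ∈ ℝ^m) satisfies ‖s⁻¹∘E‖₂ ≤ (1/3)·δ(s,μ)², then s⁺ = s + Δs + E is strictly positive entrywise (hence (y+Δy+ε, s⁺) is strictly dual feasible), and the proximity at the new iterate satisfies δ(s⁺, μ) ≤ 1.5·δ(s,μ)², where δ(s⁺,μ) = (1/μ)·min{‖μe − s⁺∘x‖₂ : Ax = b}. -/

import Mathlib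

open Matrix

/-- Euclidean norm of a vector in `ℝ^k`. -/
noncomputable def norm2 {k : ℕ} (v : Fin k → ℝ) : ℝ := Real.sqrt (∑ i, v i ^ 2)

section Norm2

variable {k : ℕ}

lemma norm2_eq_norm (v : Fin k → ℝ) : norm2 v = ‖WithLp.toLp 2 v‖ := by
  simp [norm2, EuclideanSpace.norm_eq]

lemma norm2_nonneg (v : Fin k → ℝ) : 0 ≤ norm2 v := Real.sqrt_nonneg _

lemma sq_norm2 (v : Fin k → ℝ) : norm2 v ^ 2 = ∑ i, v i ^ 2 :=
  Real.sq_sqrt (Finset.sum_nonneg fun _ _ => sq_nonneg _)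

lemma norm2_sub_le (v w : Fin k → ℝ) : norm2 (v - w) ≤ norm2 v + norm2 w := by
  simpa only [norm2_eq_norm, WithLp.toLp_sub] using norm_sub_le _ _

lemma norm2_smul {r : ℝ} (hr : 0 ≤ r) (v : Fin k → ℝ) : norm2 (r • v) = r * norm2 v := by
  rw [norm2_eq_norm, norm2_eq_norm, WithLp.toLp_smul, norm_smul, Real.norm_of_nonneg hr]

lemma abs_le_norm2 (v : Fin k → ℝ) (i : Fin k) : |v i| ≤ norm2 v := by
  simpa [norm2_eq_norm] using PiLp.norm_apply_le (WithLp.toLp 2 v) i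

/-- Entrywise multiplication by a vector bounded by `C` scales the norm by at most `C`. -/
lemma norm2_mul_le {C : ℝ} (hC : 0 ≤ C) (v w : Fin k → ℝ) (hv : ∀ i, |v i| ≤ C) :
    norm2 (v * w) ≤ C * norm2 w := by
  rw [← norm2_smul hC]
  refine Real.sqrt_le_sqrt (Finset.sum_le_sum fun i _ => ?_)
  simp only [Pi.mul_apply, Pi.smul_apply, smul_eq_mul, mul_pow]
  exact mul_le_mul_of_nonneg_right (sq_le_sq' (abs_le.1 (hv i)).1 (abs_le.1 (hv i)).2)
    (sq_nonneg _)

lemma sq_norm2_sub (v w : Fin k → ℝ) :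
    norm2 (v - w) ^ 2 = norm2 v ^ 2 - 2 * (v ⬝ᵥ w) + norm2 w ^ 2 := by
  simp only [sq_norm2, dotProduct, Finset.mul_sum, ← Finset.sum_sub_distrib,
    ← Finset.sum_add_distrib, Pi.sub_apply]
  exact Finset.sum_congr rfl fun i _ => by ring

end Norm2

lemma vecMul_injective_of_rank_eq {m n : ℕ} {A : Matrix (Fin m) (Fin n) ℝ} (h : A.rank = m) :
    Function.Injective A.vecMul := by
  rw [vecMul_injective_iff, linearIndependent_iff_card_eq_finrank_span, Set.finrank,
    ← rank_eq_finrank_span_row, h, Fintype.card_fin]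

/-- For `A` of full row rank and a positive weight `d`, the matrix `A diag(d) Aᵀ` is invertible. -/
lemma isUnit_det_mul_diagonal_mul_transpose {m n : ℕ} {A : Matrix (Fin m) (Fin n) ℝ}
    (h : A.rank = m) {d : Fin n → ℝ} (hd : ∀ i, 0 < d i) :
    IsUnit (A * diagonal d * Aᵀ).det := by
  have := (PosDef.diagonal hd).mul_mul_conjTranspose_same (vecMul_injective_of_rank_eq h)
  rw [conjTranspose_eq_transpose_of_trivial] at this
  exact this.det_pos.ne'.isUnit

/-- The point `μ s⁻¹ ∘ (e - s⁻¹ ∘ Δs)` attached to the Newton direction satisfies `A x = b`. -/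
lemma mulVec_newton_point {m n : ℕ} {A : Matrix (Fin m) (Fin n) ℝ} {b : Fin m → ℝ}
    (h : A.rank = m) {s : Fin n → ℝ} (hs : ∀ i, 0 < s i) {μ : ℝ} (hμ : 0 < μ)
    {Δy : Fin m → ℝ}
    (hΔy : Δy = (1 / μ) • ((A * diagonal (fun i => ((s i) ^ 2)⁻¹) * Aᵀ)⁻¹).mulVec
      (b - μ • A.mulVec s⁻¹)) :
    A.mulVec (μ • (s⁻¹ * (1 - s⁻¹ * -(Aᵀ.mulVec Δy)))) = b := by
  have hunit := isUnit_det_mul_diagonal_mul_transpose h (d := fun i => ((s i) ^ 2)⁻¹)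
    fun i => inv_pos.2 (pow_pos (hs i) 2)
  have hnormal : μ • A.mulVec ((diagonal fun i => ((s i) ^ 2)⁻¹).mulVec (Aᵀ.mulVec Δy)) =
      b - μ • A.mulVec s⁻¹ := by
    rw [mulVec_mulVec, mulVec_mulVec, hΔy, mulVec_smul, mulVec_mulVec,
      mul_nonsing_inv _ hunit, one_mulVec, smul_smul, mul_one_div_cancel hμ.ne', one_smul]
  have hpoint : s⁻¹ * (1 - s⁻¹ * -(Aᵀ.mulVec Δy)) =
      s⁻¹ + (diagonal fun i => ((s i) ^ 2)⁻¹).mulVec (Aᵀ.mulVec Δy) := by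
    ext i
    simp only [mulVec_diagonal, Pi.mul_apply, Pi.add_apply, Pi.sub_apply, Pi.neg_apply,
      Pi.inv_apply, Pi.one_apply, ← inv_pow]
    ring
  rw [hpoint, mulVec_smul, mulVec_add, smul_add, hnormal]
  abel

/-- A feasible point `p` whose residual `μ e - s ∘ p` is a multiple of `s⁻¹ ∘ Aᵀ w` is the unique
minimizer of `‖μ e - s ∘ x‖` subject to `A x = b`. -/
lemma eq_of_residual_orthogonal {m n : ℕ} {A : Matrix (Fin m) (Fin n) ℝ} {b : Fin m → ℝ}
    {s : Fin n → ℝ} (hs : ∀ i, 0 < s i) {μ : ℝ} {w : Fin m → ℝ} {p x : Fin n → ℝ}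
    (hp : A.mulVec p = b) (hres : μ • (1 : Fin n → ℝ) - s * p = s⁻¹ * Aᵀ.mulVec w)
    (hx : A.mulVec x = b)
    (hmin : norm2 (μ • (1 : Fin n → ℝ) - s * x) ≤ norm2 (μ • (1 : Fin n → ℝ) - s * p)) :
    x = p := by
  have horth : (s⁻¹ * Aᵀ.mulVec w) ⬝ᵥ (s * (x - p)) = 0 := by
    have hcancel : (s⁻¹ * Aᵀ.mulVec w) ⬝ᵥ (s * (x - p)) = Aᵀ.mulVec w ⬝ᵥ (x - p) := by
      refine Finset.sum_congr rfl fun i _ => ?_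
      have := (hs i).ne'
      simp only [Pi.mul_apply, Pi.inv_apply]
      field_simp
    rw [hcancel, mulVec_transpose, ← dotProduct_mulVec, mulVec_sub, hx, hp, sub_self,
      dotProduct_zero]
  have hsplit : μ • (1 : Fin n → ℝ) - s * x = (μ • 1 - s * p) - s * (x - p) := by ring
  have hsq := sq_norm2_sub (μ • 1 - s * p) (s * (x - p))
  rw [← hsplit, hres, horth, ← hres] at hsq
  have hzero : ∑ i, (s * (x - p)) i ^ 2 = 0 := by
    rw [← sq_norm2]
    have := pow_le_pow_left₀ (norm2_nonneg _) hmin 2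
    nlinarith [sq_nonneg (norm2 (s * (x - p)))]
  ext i
  have hi := (Finset.sum_eq_zero_iff_of_nonneg fun _ _ => sq_nonneg _).1 hzero i
    (Finset.mem_univ i)
  simpa [(hs i).ne', sub_eq_zero] using hi

/-- Quadratic bound on the relative residual after a full Newton step with relative
inexactness `v`. -/
lemma norm2_sq_sub_mul_le {k : ℕ} {u v : Fin k → ℝ} (hu : norm2 u ≤ 1 / 2)
    (hv : norm2 v ≤ 1 / 3 * norm2 u ^ 2) :
    norm2 (u * u - (1 - u) * v) ≤ 3 / 2 * norm2 u ^ 2 := by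
  have h₁ := norm2_mul_le (norm2_nonneg u) u u (abs_le_norm2 u)
  have h₂ := norm2_mul_le (C := 3 / 2) (by norm_num) (1 - u) v fun i => by
    have := abs_le.1 ((abs_le_norm2 u i).trans hu)
    simp only [Pi.sub_apply, Pi.one_apply]
    exact abs_le.2 ⟨by linarith, by linarith⟩
  linarith [norm2_sub_le (u * u) ((1 - u) * v)]

/-- If `δ(s,μ) ≤ 0.5` then `x(s,μ)` is primal feasible; moreover, if the
inexactness `E = -Aᵀε` satisfies `‖s⁻¹∘E‖ ≤ (1/3)δ²`, then `s⁺ = s + Δs + E` is strictly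
positive (strict dual feasibility) and `δ(s⁺,μ) ≤ 1.5 δ²`. -/
theorem stmt0 {m n : ℕ} (A : Matrix (Fin m) (Fin n) ℝ) (b : Fin m → ℝ) (c : Fin n → ℝ)
    (hrank : A.rank = m) (hmn : m ≤ n)
    (y : Fin m → ℝ) (s : Fin n → ℝ) (hs : ∀ i, 0 < s i)
    (hdual : A.transpose.mulVec y + s = c)
    (μ : ℝ) (hμ : 0 < μ)
    (rp : Fin m → ℝ) (hrp : rp = b - μ • A.mulVec s⁻¹)
    (Δy : Fin m → ℝ)
    (hΔy : Δy = (1 / μ) •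
      ((A * Matrix.diagonal (fun i => ((s i) ^ 2)⁻¹) * A.transpose)⁻¹).mulVec rp)
    (Δs : Fin n → ℝ) (hΔs : Δs = -(A.transpose.mulVec Δy))
    (δ : ℝ) (hδ : δ = norm2 (s⁻¹ * Δs)) (hδle : δ ≤ 0.5)
    (x : Fin n → ℝ) (hxfeas : A.mulVec x = b)
    (hxmin : ∀ x' : Fin n → ℝ, A.mulVec x' = b →
      norm2 (μ • (1 : Fin n → ℝ) - s * x) ≤ norm2 (μ • (1 : Fin n → ℝ) - s * x'))
    (ε : Fin m → ℝ) (E : Fin n → ℝ) (hE : E = -(A.transpose.mulVec ε))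
    (hEsmall : norm2 (s⁻¹ * E) ≤ (1 / 3) * δ ^ 2)
    (sp : Fin n → ℝ) (hsp : sp = s + Δs + E) :
    (A.mulVec x = b ∧ ∀ i, 0 ≤ x i) ∧
    (∀ i, 0 < sp i) ∧
    (A.transpose.mulVec (y + Δy + ε) + sp = c) ∧
    (1 / μ) * sInf {t : ℝ | ∃ x' : Fin n → ℝ, A.mulVec x' = b ∧
        t = norm2 (μ • (1 : Fin n → ℝ) - sp * x')} ≤ 1.5 * δ ^ 2 := by
  subst hrp
  set u : Fin n → ℝ := s⁻¹ * Δs with hu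
  set v : Fin n → ℝ := s⁻¹ * E with hv
  rw [hδ] at hEsmall hδle ⊢
  have hδ' : norm2 u ≤ 1 / 2 := by linarith
  have hxu : x = μ • (s⁻¹ * (1 - u)) := by
    have hp := mulVec_newton_point hrank hs hμ hΔy
    rw [← hΔs] at hp
    refine eq_of_residual_orthogonal hs (w := -(μ • Δy)) hp ?_ hxfeas (hxmin _ hp)
    rw [mulVec_neg, mulVec_smul, ← smul_neg, ← hΔs]
    ext i
    have := (hs i).ne'
    simp [hu]
    field_simp
    simp
  have hspuv : sp = s * (1 + u + v) := by
    ext i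
    have := (hs i).ne'
    simp [hsp, hu, hv]
    field_simp
  have hui i := abs_le.1 ((abs_le_norm2 u i).trans hδ')
  refine ⟨⟨hxfeas, fun i => ?_⟩, fun i => ?_, ?_, ?_⟩
  · rw [hxu]
    have : 0 ≤ 1 - u i := by linarith [(hui i).2]
    exact mul_nonneg hμ.le (mul_nonneg (inv_nonneg.2 (hs i).le) this)
  · rw [hspuv]
    refine mul_pos (hs i) ?_
    have hvi := (abs_le.1 ((abs_le_norm2 v i).trans hEsmall)).1
    have := (hui i).1
    simp only [Pi.add_apply, Pi.one_apply]
    nlinarith [norm2_nonneg u]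
  · rw [hsp, hΔs, hE, mulVec_add, mulVec_add, ← hdual]
    abel
  · have hres : μ • (1 : Fin n → ℝ) - sp * x = μ • (u * u - (1 - u) * v) := by
      rw [hspuv, hxu]
      ext i
      have := (hs i).ne'
      simp only [Pi.sub_apply, Pi.smul_apply, Pi.mul_apply, Pi.add_apply, Pi.one_apply,
        Pi.inv_apply, smul_eq_mul]
      field_simp
      ring
    have hle : sInf {t : ℝ | ∃ x' : Fin n → ℝ, A.mulVec x' = b ∧
        t = norm2 (μ • (1 : Fin n → ℝ) - sp * x')} ≤ μ * norm2 (u * u - (1 - u) * v) := by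
      rw [← norm2_smul hμ.le, ← hres]
      refine csInf_le ⟨0, ?_⟩ ⟨x, hxfeas, rfl⟩
      rintro t ⟨x', -, rfl⟩
      exact norm2_nonneg _
    rw [one_div, inv_mul_le_iff₀ hμ]
    refine hle.trans (mul_le_mul_of_nonneg_left ?_ hμ.le)
    linarith [norm2_sq_sub_mul_le hδ' hEsmall]
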